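/- Let D = (V, A) be a digraph, k a positive integer, and let S ⊆ (V × V) \ A be a loopless arc set of minimum size such that D + S is k-anonymous. Let V(S) denote the set of vertices incident to at least one arc of S. If |V(S)| ≥ 4k(Δ_D + 2)², then Δ_{D+S} ≤ Δ_D + 2. -/

import Mathlib

/-- Indegree of vertex `v` in the digraph with arc set `A`. -/
def inDeg {V : Type*} [DecidableEq V] (A : Finset (V × V)) (v : V) : ℕ :=
  (A.filter fun a => a.2 = v).card

/-- Outdegree of vertex `v` in the digraph with arc set `A`. -/
def outDeg {V : Type*} [DecidableEq V] (A : Finset (V × V)) (v : V) : ℕ :=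
  (A.filter fun a => a.1 = v).card

/-- Degree pair (indegree, outdegree) of vertex `v`. -/
def deg {V : Type*} [DecidableEq V] (A : Finset (V × V)) (v : V) : ℕ × ℕ :=
  (inDeg A v, outDeg A v)

/-- Maximum in- or outdegree in the digraph with arc set `A`. -/
def maxDeg {V : Type*} [Fintype V] [DecidableEq V] (A : Finset (V × V)) : ℕ :=
  Finset.univ.sup fun v => max (inDeg A v) (outDeg A v)

/-- The set of vertices incident to at least one arc of `S`. -/
def incidentVerts {V : Type*} [DecidableEq V] (S : Finset (V × V)) : Finset V :=
  S.image Prod.fst ∪ S.image Prod.snd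

/-- The digraph with arc set `A` is `k`-anonymous: every vertex shares its
degree pair with at least `k` vertices (itself included). -/
def kAnonymous {V : Type*} [Fintype V] [DecidableEq V]
    (A : Finset (V × V)) (k : ℕ) : Prop :=
  ∀ v : V, k ≤ (Finset.univ.filter fun u : V => deg A u = deg A v).card

section Realization

variable {V : Type*} [DecidableEq V]

lemma inDeg_insert {S : Finset (V × V)} {x y : V} (h : (x, y) ∉ S) (v : V) :
    inDeg (insert (x, y) S) v = inDeg S v + if y = v then 1 else 0 := by
  unfold inDeg
  rw [Finset.filter_insert]
  split_ifs with hy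
  · rw [Finset.card_insert_of_notMem (by simp [h])]
  · rfl

lemma outDeg_insert {S : Finset (V × V)} {x y : V} (h : (x, y) ∉ S) (v : V) :
    outDeg (insert (x, y) S) v = outDeg S v + if x = v then 1 else 0 := by
  unfold outDeg
  rw [Finset.filter_insert]
  split_ifs with hy
  · rw [Finset.card_insert_of_notMem (by simp [h])]
  · rfl

lemma deg_union_of_disjoint {A S : Finset (V × V)} (h : ∀ a ∈ S, a ∉ A) (v : V) :
    deg (A ∪ S) v = (inDeg A v + inDeg S v, outDeg A v + outDeg S v) := by
  have hd : Disjoint A S := Finset.disjoint_right.2 h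
  unfold deg inDeg outDeg
  rw [Finset.filter_union, Finset.filter_union,
    Finset.card_union_of_disjoint (Finset.disjoint_filter_filter hd),
    Finset.card_union_of_disjoint (Finset.disjoint_filter_filter hd)]

lemma card_filter_fst_mem (S : Finset (V × V)) (W : Finset V) :
    (S.filter fun a => a.1 ∈ W).card = ∑ w ∈ W, outDeg S w := by
  rw [Finset.card_eq_sum_card_fiberwise (f := Prod.fst) (t := W) (by intro a; simp)]
  refine Finset.sum_congr rfl fun w hw => ?_
  unfold outDeg
  congr 1
  ext a
  simp only [Finset.mem_filter]
  constructor
  · rintro ⟨⟨h1, _⟩, h3⟩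
    exact ⟨h1, h3⟩
  · rintro ⟨h1, h3⟩
    exact ⟨⟨h1, h3 ▸ hw⟩, h3⟩

lemma card_filter_snd_mem (S : Finset (V × V)) (W : Finset V) :
    (S.filter fun a => a.2 ∈ W).card = ∑ w ∈ W, inDeg S w := by
  rw [Finset.card_eq_sum_card_fiberwise (f := Prod.snd) (t := W) (by intro a; simp)]
  refine Finset.sum_congr rfl fun w hw => ?_
  unfold inDeg
  congr 1
  ext a
  simp only [Finset.mem_filter]
  constructor
  · rintro ⟨⟨h1, _⟩, h3⟩
    exact ⟨h1, h3⟩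
  · rintro ⟨h1, h3⟩
    exact ⟨⟨h1, h3 ▸ hw⟩, h3⟩

variable [Fintype V]

lemma sum_inDeg (S : Finset (V × V)) : ∑ v, inDeg S v = S.card :=
  (Finset.card_eq_sum_card_fiberwise (f := Prod.snd) (t := Finset.univ) (by simp)).symm

lemma sum_outDeg (S : Finset (V × V)) : ∑ v, outDeg S v = S.card :=
  (Finset.card_eq_sum_card_fiberwise (f := Prod.fst) (t := Finset.univ) (by simp)).symm

/-- The vertices `w` such that the arc `(w, u)` is a loop or already present. -/
def blockedTails (B : Finset (V × V)) (u : V) : Finset V :=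
  Finset.univ.filter fun w => w = u ∨ (w, u) ∈ B

/-- The vertices `z` such that the arc `(v, z)` is a loop or already present. -/
def blockedHeads (B : Finset (V × V)) (v : V) : Finset V :=
  Finset.univ.filter fun z => z = v ∨ (v, z) ∈ B

lemma card_blockedTails_le (A S : Finset (V × V)) (u : V) :
    (blockedTails (A ∪ S) u).card ≤ inDeg A u + inDeg S u + 1 := by
  have hsub : blockedTails (A ∪ S) u ⊆ insert u
      ((A.filter fun a => a.2 = u).image Prod.fst ∪
        (S.filter fun a => a.2 = u).image Prod.fst) := by
    intro w hw
    simp only [blockedTails, Finset.mem_filter, Finset.mem_univ, true_and, Finset.mem_union] at hw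
    simp only [Finset.mem_insert, Finset.mem_union, Finset.mem_image, Finset.mem_filter]
    rcases hw with h | h | h
    · exact Or.inl h
    · exact Or.inr (Or.inl ⟨(w, u), ⟨h, rfl⟩, rfl⟩)
    · exact Or.inr (Or.inr ⟨(w, u), ⟨h, rfl⟩, rfl⟩)
  refine (Finset.card_le_card hsub).trans ((Finset.card_insert_le _ _).trans ?_)
  refine Nat.succ_le_succ ((Finset.card_union_le _ _).trans ?_)
  exact add_le_add Finset.card_image_le Finset.card_image_le

lemma card_blockedHeads_le (A S : Finset (V × V)) (v : V) :
    (blockedHeads (A ∪ S) v).card ≤ outDeg A v + outDeg S v + 1 := by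
  have hsub : blockedHeads (A ∪ S) v ⊆ insert v
      ((A.filter fun a => a.1 = v).image Prod.snd ∪
        (S.filter fun a => a.1 = v).image Prod.snd) := by
    intro w hw
    simp only [blockedHeads, Finset.mem_filter, Finset.mem_univ, true_and, Finset.mem_union] at hw
    simp only [Finset.mem_insert, Finset.mem_union, Finset.mem_image, Finset.mem_filter]
    rcases hw with h | h | h
    · exact Or.inl h
    · exact Or.inr (Or.inl ⟨(v, w), ⟨h, rfl⟩, rfl⟩)
    · exact Or.inr (Or.inr ⟨(v, w), ⟨h, rfl⟩, rfl⟩)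
  refine (Finset.card_le_card hsub).trans ((Finset.card_insert_le _ _).trans ?_)
  refine Nat.succ_le_succ ((Finset.card_union_le _ _).trans ?_)
  exact add_le_add Finset.card_image_le Finset.card_image_le

/-- An arc set respecting the demands `f`, `g` and admitting enough arcs can be enlarged by
replacing one arc `(w, z)` by the two arcs `(w, u)` and `(v, z)`. -/
lemma exists_larger_by_exchange {A S : Finset (V × V)} {f g : V → ℕ} {r : ℕ}
    (hf : ∀ v, inDeg A v + f v ≤ r) (hg : ∀ v, outDeg A v + g v ≤ r)
    (hSA : ∀ a ∈ S, a ∉ A) (hS : ∀ v, (v, v) ∉ S)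
    (hSf : ∀ v, inDeg S v ≤ f v) (hSg : ∀ v, outDeg S v ≤ g v)
    {u v : V} (hu : inDeg S u < f u) (hv : outDeg S v < g v) (hlarge : 2 * r ^ 2 < S.card) :
    ∃ S' : Finset (V × V), (∀ a ∈ S', a ∉ A) ∧ (∀ v, (v, v) ∉ S') ∧
      (∀ v, inDeg S' v ≤ f v) ∧ (∀ v, outDeg S' v ≤ g v) ∧ S'.card = S.card + 1 := by
  have h1 : (S.filter fun a => a.1 ∈ blockedTails (A ∪ S) u).card ≤ r ^ 2 := by
    rw [card_filter_fst_mem]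
    refine (Finset.sum_le_card_nsmul _ _ r fun w _ => ?_).trans ?_
    · have := hSg w; have := hg w; omega
    · rw [smul_eq_mul, sq]
      refine Nat.mul_le_mul_right _ ((card_blockedTails_le A S u).trans ?_)
      have := hf u; omega
  have h2 : (S.filter fun a => a.2 ∈ blockedHeads (A ∪ S) v).card ≤ r ^ 2 := by
    rw [card_filter_snd_mem]
    refine (Finset.sum_le_card_nsmul _ _ r fun w _ => ?_).trans ?_
    · have := hSf w; have := hf w; omega
    · rw [smul_eq_mul, sq]
      refine Nat.mul_le_mul_right _ ((card_blockedHeads_le A S v).trans ?_)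
      have := hg v; omega
  obtain ⟨e, hwz, hfree⟩ : ∃ e : V × V, e ∈ S ∧
      e ∉ (S.filter fun a : V × V => a.1 ∈ blockedTails (A ∪ S) u) ∪
        (S.filter fun a : V × V => a.2 ∈ blockedHeads (A ∪ S) v) := by
    refine Finset.exists_mem_notMem_of_card_lt_card ?_
    have := Finset.card_union_le (S.filter fun a => a.1 ∈ blockedTails (A ∪ S) u)
      (S.filter fun a => a.2 ∈ blockedHeads (A ∪ S) v)
    omega
  obtain ⟨w, z⟩ := e
  simp only [blockedTails, blockedHeads, Finset.mem_union, Finset.mem_filter, Finset.mem_univ,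
    true_and, hwz, not_or] at hfree
  obtain ⟨⟨hwu, hwuA, hwuS⟩, ⟨hzv, hvzA, hvzS⟩⟩ := hfree
  set S0 := S.erase (w, z) with hS0
  have hSins : S = insert (w, z) S0 := (Finset.insert_erase hwz).symm
  have hn0 : (w, z) ∉ S0 := Finset.notMem_erase _ _
  have hn1 : (w, u) ∉ S0 := fun h => hwuS (Finset.mem_of_mem_erase h)
  have hn2 : (v, z) ∉ insert (w, u) S0 := by
    rw [Finset.mem_insert, not_or]
    refine ⟨fun h => ?_, fun h => hvzS (Finset.mem_of_mem_erase h)⟩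
    rw [Prod.mk.injEq] at h
    exact hwuS (h.2 ▸ hwz)
  refine ⟨insert (v, z) (insert (w, u) S0), ?_, ?_, ?_, ?_, ?_⟩
  · intro a ha
    rw [Finset.mem_insert, Finset.mem_insert] at ha
    rcases ha with rfl | rfl | ha
    · exact hvzA
    · exact hwuA
    · exact hSA a (Finset.mem_of_mem_erase ha)
  · intro x hx
    rw [Finset.mem_insert, Finset.mem_insert, Prod.mk.injEq, Prod.mk.injEq] at hx
    rcases hx with ⟨h1, h2⟩ | ⟨h1, h2⟩ | hx
    · exact hzv (h2.symm.trans h1)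
    · exact hwu (h1.symm.trans h2)
    · exact hS x (Finset.mem_of_mem_erase hx)
  · intro x
    have hx := hSf x
    have e : inDeg S x = inDeg S0 x + if z = x then 1 else 0 := by
      conv_lhs => rw [hSins]
      exact inDeg_insert hn0 x
    rw [inDeg_insert hn2, inDeg_insert hn1]
    by_cases hxu : u = x
    · subst hxu
      rw [if_pos rfl]; omega
    · rw [if_neg hxu]; omega
  · intro x
    have hx := hSg x
    have e : outDeg S x = outDeg S0 x + if w = x then 1 else 0 := by
      conv_lhs => rw [hSins]
      exact outDeg_insert hn0 x
    rw [outDeg_insert hn2, outDeg_insert hn1]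
    by_cases hxv : v = x
    · subst hxv
      rw [if_pos rfl]; omega
    · rw [if_neg hxv]; omega
  · rw [Finset.card_insert_of_notMem hn2, Finset.card_insert_of_notMem hn1, hSins,
      Finset.card_insert_of_notMem hn0]

/-- If the outstanding indegree demand exceeds `r ^ 2`, then a single arc leaving `v` can be
added. -/
lemma exists_larger_by_insert {A S : Finset (V × V)} {f g : V → ℕ} {r : ℕ}
    (hf : ∀ v, inDeg A v + f v ≤ r) (hg : ∀ v, outDeg A v + g v ≤ r)
    (hSA : ∀ a ∈ S, a ∉ A) (hS : ∀ v, (v, v) ∉ S)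
    (hSf : ∀ v, inDeg S v ≤ f v) (hSg : ∀ v, outDeg S v ≤ g v)
    {v : V} (hv : outDeg S v < g v) (hlarge : S.card + r ^ 2 < ∑ v, f v) :
    ∃ S' : Finset (V × V), (∀ a ∈ S', a ∉ A) ∧ (∀ v, (v, v) ∉ S') ∧
      (∀ v, inDeg S' v ≤ f v) ∧ (∀ v, outDeg S' v ≤ g v) ∧ S'.card = S.card + 1 := by
  obtain ⟨u, hub, hu⟩ : ∃ u, u ∉ blockedHeads (A ∪ S) v ∧ inDeg S u < f u := by
    by_contra! hcon
    have hle : ∑ x, f x ≤ ∑ x, (inDeg S x + if x ∈ blockedHeads (A ∪ S) v then r else 0) := by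
      refine Finset.sum_le_sum fun x _ => ?_
      split_ifs with hx
      · have := hf x; omega
      · exact hcon x hx
    rw [Finset.sum_add_distrib, sum_inDeg, Finset.sum_ite_mem, Finset.univ_inter,
      Finset.sum_const, smul_eq_mul] at hle
    have hc : (blockedHeads (A ∪ S) v).card ≤ r := by
      have := card_blockedHeads_le A S v
      have := hg v
      omega
    have := Nat.mul_le_mul_right r hc
    rw [sq] at hlarge
    omega
  simp only [blockedHeads, Finset.mem_union, Finset.mem_filter, Finset.mem_univ, true_and,
    not_or] at hub
  obtain ⟨huv, hA, hn⟩ := hub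
  refine ⟨insert (v, u) S, ?_, ?_, ?_, ?_, Finset.card_insert_of_notMem hn⟩
  · intro a ha
    rcases Finset.mem_insert.1 ha with rfl | ha
    · exact hA
    · exact hSA a ha
  · intro x hx
    rw [Finset.mem_insert, Prod.mk.injEq] at hx
    rcases hx with ⟨h1, h2⟩ | hx
    · exact huv (h2.symm.trans h1)
    · exact hS x hx
  · intro x
    rw [inDeg_insert hn]
    split_ifs with h
    · subst h; omega
    · exact hSf x
  · intro x
    rw [outDeg_insert hn]
    split_ifs with h
    · subst h; omega
    · exact hSg x

/-- Balanced degree demands with bounded resulting degrees and large total are realizable by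
inserting arcs. -/
lemma exists_realization (A : Finset (V × V)) (f g : V → ℕ) (r : ℕ)
    (hf : ∀ v, inDeg A v + f v ≤ r) (hg : ∀ v, outDeg A v + g v ≤ r)
    (hfg : ∑ v, f v = ∑ v, g v) (hT : 3 * r ^ 2 < ∑ v, f v) :
    ∃ S : Finset (V × V), (∀ a ∈ S, a ∉ A) ∧ (∀ v, (v, v) ∉ S) ∧
      (∀ v, inDeg S v = f v) ∧ (∀ v, outDeg S v = g v) := by
  classical
  obtain ⟨S, hSmem, hSmax⟩ := Finset.exists_max_image
    (Finset.univ.filter fun S : Finset (V × V) => (∀ a ∈ S, a ∉ A) ∧ (∀ v, (v, v) ∉ S) ∧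
      (∀ v, inDeg S v ≤ f v) ∧ (∀ v, outDeg S v ≤ g v)) Finset.card
    ⟨∅, by simp [inDeg, outDeg]⟩
  simp only [Finset.mem_filter, Finset.mem_univ, true_and] at hSmem hSmax
  obtain ⟨hSA, hS, hSf, hSg⟩ := hSmem
  have hle : S.card ≤ ∑ v, f v := by
    rw [← sum_inDeg S]
    exact Finset.sum_le_sum fun v _ => hSf v
  rcases hle.lt_or_eq with hlt | heq
  · exfalso
    obtain ⟨u, -, hu⟩ : ∃ u ∈ Finset.univ, inDeg S u < f u :=
      Finset.exists_lt_of_sum_lt (by rwa [sum_inDeg])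
    obtain ⟨v, -, hv⟩ : ∃ v ∈ Finset.univ, outDeg S v < g v :=
      Finset.exists_lt_of_sum_lt (by rwa [sum_outDeg, ← hfg])
    obtain ⟨S', h1, h2, h3, h4, h5⟩ : ∃ S' : Finset (V × V), (∀ a ∈ S', a ∉ A) ∧
        (∀ v, (v, v) ∉ S') ∧ (∀ v, inDeg S' v ≤ f v) ∧ (∀ v, outDeg S' v ≤ g v) ∧
        S'.card = S.card + 1 := by
      by_cases hc : 2 * r ^ 2 < S.card
      · exact exists_larger_by_exchange hf hg hSA hS hSf hSg hu hv hc
      · exact exists_larger_by_insert hf hg hSA hS hSf hSg hv (by omega)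
    have := hSmax S' ⟨h1, h2, h3, h4⟩
    omega
  · refine ⟨S, hSA, hS, fun v => ?_, fun v => ?_⟩
    · exact (Finset.sum_eq_sum_iff_of_le fun v _ => hSf v).1 (by rw [sum_inDeg, heq]) v
        (Finset.mem_univ v)
    · exact (Finset.sum_eq_sum_iff_of_le fun v _ => hSg v).1 (by rw [sum_outDeg, heq, hfg]) v
        (Finset.mem_univ v)

end Realization

section Anonymization

variable {V : Type*}

/-- Raising values bounded by `m` so that all levels below `m` are empty or have at least `k`
elements costs at most `k * m`. -/
lemma exists_raise_levels (X : Finset V) (h : V → ℕ) (k m : ℕ) (hm : ∀ v ∈ X, h v ≤ m) :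
    ∃ h' : V → ℕ, (∀ v, h v ≤ h' v) ∧ (∀ v ∈ X, h' v ≤ m) ∧
      ∑ v ∈ X, h' v ≤ ∑ v ∈ X, h v + k * m ∧
      ∀ v ∈ X, h' v < m → k ≤ (X.filter fun u => h' u = h' v).card := by
  suffices H : ∀ j ≤ m, ∃ h' : V → ℕ, (∀ v, h v ≤ h' v) ∧ (∀ v ∈ X, h' v ≤ m) ∧
      ∑ v ∈ X, h' v ≤ ∑ v ∈ X, h v + k * j ∧
      ∀ v ∈ X, h' v < j → k ≤ (X.filter fun u => h' u = h' v).card from H m le_rfl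
  intro j
  induction j with
  | zero => exact fun _ => ⟨h, fun _ => le_rfl, hm, by simp, by simp⟩
  | succ j ih =>
    intro hj
    obtain ⟨h₁, hge, hle, hsum, hgood⟩ := ih (by omega)
    by_cases hc : k ≤ (X.filter fun u => h₁ u = j).card
    · refine ⟨h₁, hge, hle, hsum.trans (by gcongr; omega), fun v hv hvj => ?_⟩
      rcases (Nat.lt_succ_iff.1 hvj).lt_or_eq with hlt | heq
      · exact hgood v hv hlt
      · rwa [heq]
    · refine ⟨fun v => h₁ v + if h₁ v = j then 1 else 0, fun v => (hge v).trans (by simp), ?_, ?_,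
        ?_⟩
      · intro v hv
        have := hle v hv
        dsimp only
        split_ifs <;> omega
      · rw [Finset.sum_add_distrib, Finset.sum_ite, Finset.sum_const_zero, Finset.sum_const,
          smul_eq_mul, mul_one, Nat.mul_succ]
        omega
      · intro v hv hvj
        dsimp only at hvj
        have hvlt : h₁ v < j := by split_ifs at hvj <;> omega
        refine (hgood v hv hvlt).trans (Finset.card_le_card fun u => ?_)
        simp only [Finset.mem_filter]
        rintro ⟨hu, he⟩
        refine ⟨hu, ?_⟩
        rw [if_neg (by omega), if_neg (by omega), he]

variable [Fintype V]

lemma exists_large_fiber (a b : V → ℕ) (m n : ℕ) (ha : ∀ v, a v < n) (hb : ∀ v, b v < n)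
    (hn : 0 < n) (hcard : m * n ^ 2 ≤ Fintype.card V) :
    ∃ t : ℕ × ℕ, m ≤ (Finset.univ.filter fun u => (a u, b u) = t).card := by
  obtain ⟨t, -, ht⟩ := Finset.exists_le_card_fiber_of_mul_le_card_of_maps_to
    (s := (Finset.univ : Finset V)) (t := Finset.range n ×ˢ Finset.range n)
    (f := fun u => (a u, b u)) (n := m) (by simp [ha, hb]) ⟨(0, 0), by simp [hn]⟩
    (by rw [Finset.card_product, Finset.card_range, Finset.card_univ]; nlinarith)
  exact ⟨t, ht⟩

/-- Pairs of values bounded by `d` can be raised, staying bounded by `d`, so that all nonempty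
fibres other than that of `(d, d)` have at least `k` elements. -/
lemma exists_raise_pairs (p q : V → ℕ) (k d : ℕ) (hp : ∀ v, p v ≤ d) (hq : ∀ v, q v ≤ d) :
    ∃ a b : V → ℕ, (∀ v, p v ≤ a v) ∧ (∀ v, q v ≤ b v) ∧ (∀ v, a v ≤ d) ∧ (∀ v, b v ≤ d) ∧
      ∑ v, a v ≤ ∑ v, p v + k * d * (d + 1) ∧ ∑ v, b v ≤ ∑ v, q v + k * d ∧
      ∀ v, (a v, b v) ≠ (d, d) →
        k ≤ (Finset.univ.filter fun u => (a u, b u) = (a v, b v)).card := by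
  choose H hge hle hsum hgood using fun o : ℕ =>
    exists_raise_levels (Finset.univ.filter fun v => q v = o) p k d (fun v _ => hp v)
  obtain ⟨G, Gge, Gle, Gsum, Ggood⟩ :=
    exists_raise_levels (Finset.univ.filter fun v => H (q v) v = d) q k d (fun v _ => hq v)
  simp only [Finset.mem_filter, Finset.mem_univ, true_and] at hle hgood Gle Ggood
  refine ⟨fun v => H (q v) v, fun v => if H (q v) v = d then G v else q v, fun v => hge _ v,
    fun v => ?_, fun v => hle _ v rfl, fun v => ?_, ?_, ?_, fun v hv => ?_⟩
  · dsimp only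
    split_ifs
    · exact Gge v
    · exact le_rfl
  · dsimp only
    split_ifs with h
    · exact Gle v h
    · exact hq v
  · have hmaps : ∀ v ∈ (Finset.univ : Finset V), q v ∈ Finset.range (d + 1) := fun v _ =>
      Finset.mem_range.2 (Nat.lt_succ_of_le (hq v))
    rw [← Finset.sum_fiberwise_of_maps_to hmaps, ← Finset.sum_fiberwise_of_maps_to hmaps]
    have hrow : ∀ o ∈ Finset.range (d + 1),
        ∑ v ∈ Finset.univ.filter (fun v => q v = o), H (q v) v ≤
          ∑ v ∈ Finset.univ.filter (fun v => q v = o), p v + k * d := fun o _ => by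
      refine le_of_eq_of_le (Finset.sum_congr rfl fun v hv => ?_) (hsum o)
      rw [(Finset.mem_filter.1 hv).2]
    refine (Finset.sum_le_sum hrow).trans_eq ?_
    rw [Finset.sum_add_distrib, Finset.sum_const, Finset.card_range, smul_eq_mul]
    ring
  · rw [Finset.sum_ite, ← Finset.sum_filter_add_sum_filter_not Finset.univ
      (fun v => H (q v) v = d) q]
    omega
  · dsimp only at hv ⊢
    by_cases hvd : H (q v) v = d
    · simp only [hvd, if_true] at hv ⊢
      have hlt : G v < d := lt_of_le_of_ne (Gle v hvd) fun h => hv (by rw [h])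
      refine (Ggood v hvd hlt).trans (Finset.card_le_card fun u => ?_)
      simp only [Finset.mem_filter, Finset.mem_univ, true_and]
      rintro ⟨h1, h2⟩
      rw [if_pos h1, h1, h2]
    · have hlt : H (q v) v < d := lt_of_le_of_ne (hle _ v rfl) hvd
      refine (hgood (q v) v rfl hlt).trans (Finset.card_le_card fun u => ?_)
      simp only [Finset.mem_filter, Finset.mem_univ, true_and]
      rintro ⟨h1, h2⟩
      rw [h1, h2, if_neg hvd, if_neg hvd]

variable [DecidableEq V]

/-- A function all of whose nonempty fibres have at least `k` elements, one of them at least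
`4 * k`, can be refined by a set of any prescribed size between `k` and `card V - k`. -/
lemma exists_refining_set {α : Type*} [DecidableEq α] (c : V → α) (k x : ℕ)
    (hgood : ∀ v, k ≤ (Finset.univ.filter fun u => c u = c v).card)
    (t : α) (ht : 4 * k ≤ (Finset.univ.filter fun u => c u = t).card)
    (hkx : k ≤ x) (hx : x + k ≤ Fintype.card V) :
    ∃ W : Finset V, W.card = x ∧
      ∀ v, k ≤ (Finset.univ.filter fun u => c u = c v ∧ (u ∈ W ↔ v ∈ W)).card := by
  classical
  rcases Nat.eq_zero_or_pos k with rfl | hk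
  · obtain ⟨W, -, hW⟩ := Finset.exists_subset_card_eq (s := (Finset.univ : Finset V)) (n := x)
      (by rw [Finset.card_univ]; omega)
    exact ⟨W, hW, fun _ => Nat.zero_le _⟩
  set B := Finset.univ.filter fun u => c u = t with hB
  obtain ⟨W, hWmem, hWmax⟩ := Finset.exists_max_image
    (Finset.univ.filter fun W : Finset V => Disjoint W B ∧ W.card + k ≤ x ∧
      ∀ v ∉ B, k ≤ (Finset.univ.filter fun u => c u = c v ∧ (u ∈ W ↔ v ∈ W)).card) Finset.card
    ⟨∅, by simpa [hkx] using fun v _ => hgood v⟩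
  simp only [Finset.mem_filter, Finset.mem_univ, true_and] at hWmem hWmax
  obtain ⟨hWB, hWx, hWgood⟩ := hWmem
  have hrest : x - W.card + k ≤ B.card := by
    by_contra! hcon
    obtain ⟨v, -, hv⟩ : ∃ v ∈ Finset.univ, v ∉ W ∪ B := by
      refine Finset.exists_mem_notMem_of_card_lt_card ?_
      rw [Finset.card_union_of_disjoint hWB, Finset.card_univ]
      omega
    rw [Finset.mem_union, not_or] at hv
    obtain ⟨hvW, hvB⟩ := hv
    set R := Finset.univ.filter fun u => c u = c v ∧ u ∉ W with hR
    have hRk : k ≤ R.card := by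
      simpa [hvW, hR] using hWgood v hvB
    obtain ⟨E, hER, hE1, hE2, hE3⟩ : ∃ E ⊆ R, k ≤ E.card ∧ E.card ≤ 2 * k ∧
        (E = R ∨ k ≤ (R \ E).card) := by
      by_cases h2 : R.card ≤ 2 * k
      · exact ⟨R, subset_rfl, hRk, h2, Or.inl rfl⟩
      · obtain ⟨E, hER, hE⟩ := Finset.exists_subset_card_eq hRk
        refine ⟨E, hER, hE.ge, by omega, Or.inr ?_⟩
        rw [Finset.card_sdiff_of_subset hER]
        omega
    have hEmem : ∀ u ∈ E, c u = c v ∧ u ∉ W := fun u hu => by simpa [hR] using hER hu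
    have hEW : Disjoint W E := Finset.disjoint_right.2 fun u hu => (hEmem u hu).2
    have hcard := Finset.card_union_of_disjoint hEW
    have := hWmax (W ∪ E) ⟨?_, by omega, ?_⟩
    · omega
    · refine Finset.disjoint_union_left.2 ⟨hWB, Finset.disjoint_left.2 fun u hu huB => hvB ?_⟩
      simp only [hB, Finset.mem_filter, Finset.mem_univ, true_and] at huB ⊢
      rw [← (hEmem u hu).1, huB]
    · intro y hyB
      by_cases hyv : c y = c v
      · by_cases hyW : y ∈ W
        · refine (hWgood y hyB).trans (Finset.card_le_card fun u => ?_)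
          simp only [Finset.mem_filter, Finset.mem_univ, true_and, Finset.mem_union]
          tauto
        · by_cases hyE : y ∈ E
          · refine hE1.trans (Finset.card_le_card fun u hu => ?_)
            have := hEmem u hu
            simp only [Finset.mem_filter, Finset.mem_univ, true_and, Finset.mem_union]
            exact ⟨this.1.trans hyv.symm, by tauto⟩
          · rcases hE3 with rfl | hE3
            · exact absurd (by simp [hR, hyv, hyW]) hyE
            · refine hE3.trans (Finset.card_le_card fun u => ?_)
              simp only [hR, Finset.mem_sdiff, Finset.mem_filter, Finset.mem_univ, true_and,
                Finset.mem_union]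
              rintro ⟨⟨h1, h2⟩, h3⟩
              exact ⟨h1.trans hyv.symm, by tauto⟩
      · refine (hWgood y hyB).trans (Finset.card_le_card fun u => ?_)
        simp only [Finset.mem_filter, Finset.mem_univ, true_and, Finset.mem_union]
        rintro ⟨h1, h2⟩
        have huE : u ∉ E := fun h => hyv (h1.symm.trans (hEmem u h).1)
        have hyE : y ∉ E := fun h => hyv (hEmem y h).1
        exact ⟨h1, by tauto⟩
  obtain ⟨F, hFB, hF⟩ := Finset.exists_subset_card_eq (s := B) (n := x - W.card) (by omega)
  have hWF : Disjoint W F := hWB.mono_right hFB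
  have hBmem : ∀ u, u ∈ B ↔ c u = t := fun u => by simp [hB]
  refine ⟨W ∪ F, by rw [Finset.card_union_of_disjoint hWF]; omega, fun v => ?_⟩
  by_cases hvB : v ∈ B
  · have hvW : v ∉ W := Finset.disjoint_right.1 hWB hvB
    by_cases hvF : v ∈ F
    · refine (show k ≤ F.card by omega).trans (Finset.card_le_card fun u hu => ?_)
      have hct := ((hBmem u).1 (hFB hu)).trans ((hBmem v).1 hvB).symm
      simp only [Finset.mem_filter, Finset.mem_univ, true_and, Finset.mem_union]
      exact ⟨hct, by tauto⟩
    · have : k ≤ (B \ F).card := by rw [Finset.card_sdiff_of_subset hFB]; omega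
      refine this.trans (Finset.card_le_card fun u hu => ?_)
      rw [Finset.mem_sdiff] at hu
      have hct := ((hBmem u).1 hu.1).trans ((hBmem v).1 hvB).symm
      have huW : u ∉ W := Finset.disjoint_right.1 hWB hu.1
      simp only [Finset.mem_filter, Finset.mem_univ, true_and, Finset.mem_union]
      exact ⟨hct, by tauto⟩
  · refine (hWgood v hvB).trans (Finset.card_le_card fun u => ?_)
    simp only [Finset.mem_filter, Finset.mem_univ, true_and, Finset.mem_union]
    rintro ⟨h1, h2⟩
    have huB : u ∉ B := fun h => hvB ((hBmem v).2 (h1 ▸ (hBmem u).1 h))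
    have huF : u ∉ F := fun h => huB (hFB h)
    have hvF : v ∉ F := fun h => hvB (hFB h)
    exact ⟨h1, by tauto⟩

/-- Moving `k` elements of a large fibre to `(d, d)` makes all nonempty fibres have at least `k`
elements. -/
lemma exists_raise_pairs_anonymous (p q : V → ℕ) (k d : ℕ) (hp : ∀ v, p v ≤ d)
    (hq : ∀ v, q v ≤ d) (hcard : 4 * k * (d + 2) ^ 2 ≤ Fintype.card V) :
    ∃ a b : V → ℕ, (∀ v, p v ≤ a v) ∧ (∀ v, q v ≤ b v) ∧ (∀ v, a v ≤ d) ∧ (∀ v, b v ≤ d) ∧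
      ∑ v, a v ≤ ∑ v, p v + k * d * (d + 2) ∧ ∑ v, b v ≤ ∑ v, q v + k * d * 2 ∧
      ∀ v, k ≤ (Finset.univ.filter fun u => (a u, b u) = (a v, b v)).card := by
  obtain ⟨a, b, hpa, hqb, had, hbd, hsa, hsb, hgood⟩ := exists_raise_pairs p q k d hp hq
  obtain ⟨t, ht⟩ := exists_large_fiber a b (4 * k) (d + 2) (fun v => by have := had v; omega)
    (fun v => by have := hbd v; omega) (by omega) hcard
  obtain ⟨P, hPB, hP⟩ := Finset.exists_subset_card_eq (show k ≤ _ from le_trans (by omega) ht)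
  have hPt : ∀ u ∈ P, (a u, b u) = t := fun u hu => by simpa using hPB hu
  have hsum : ∀ h : V → ℕ, ∑ v, (if v ∈ P then d else h v) ≤ ∑ v, h v + k * d := fun h => by
    calc ∑ v, (if v ∈ P then d else h v) ≤ ∑ v, (h v + if v ∈ P then d else 0) :=
          Finset.sum_le_sum fun v _ => by split_ifs <;> omega
      _ = ∑ v, h v + k * d := by
          rw [Finset.sum_add_distrib, Finset.sum_ite_mem, Finset.univ_inter, Finset.sum_const, hP,
            smul_eq_mul]
  refine ⟨fun v => if v ∈ P then d else a v, fun v => if v ∈ P then d else b v,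
    fun v => ?_, fun v => ?_, fun v => ?_, fun v => ?_, ?_, ?_, fun v => ?_⟩
  · dsimp only
    split_ifs
    exacts [hp v, hpa v]
  · dsimp only
    split_ifs
    exacts [hq v, hqb v]
  · dsimp only
    split_ifs
    exacts [le_rfl, had v]
  · dsimp only
    split_ifs
    exacts [le_rfl, hbd v]
  · have := hsum a
    have e : k * d * (d + 2) = k * d * (d + 1) + k * d := by ring
    dsimp only
    omega
  · have := hsum b
    dsimp only
    have e : k * d * 2 = k * d + k * d := by ring
    omega
  · dsimp only
    by_cases hv : ((if v ∈ P then d else a v), (if v ∈ P then d else b v)) = (d, d)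
    · rw [hv]
      refine hP.ge.trans (Finset.card_le_card fun u hu => ?_)
      simp [hu]
    · have hvP : v ∉ P := fun h => hv (by simp [h])
      simp only [if_neg hvP] at hv ⊢
      by_cases hvt : (a v, b v) = t
      · have hk : k ≤ ((Finset.univ.filter fun u => (a u, b u) = t) \ P).card := by
          rw [Finset.card_sdiff_of_subset hPB]
          omega
        refine hk.trans (Finset.card_le_card fun u => ?_)
        simp only [Finset.mem_sdiff, Finset.mem_filter, Finset.mem_univ, true_and]
        rintro ⟨h1, h2⟩
        rw [if_neg h2, if_neg h2, h1, hvt]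
      · refine (hgood v hv).trans (Finset.card_le_card fun u => ?_)
        simp only [Finset.mem_filter, Finset.mem_univ, true_and]
        intro h
        have huP : u ∉ P := fun hu => hvt (h ▸ hPt u hu)
        rw [if_neg huP, if_neg huP, h]

/-- The first components of pairs can be raised by at most one each, by any prescribed total
amount that is neither too small nor too large, keeping all nonempty fibres of size at
least `k`. -/
lemma exists_raise_fst (a b : V → ℕ) (k n x : ℕ) (hn : 0 < n)
    (ha : ∀ v, a v < n) (hb : ∀ v, b v < n) (hcard : 4 * k * n ^ 2 ≤ Fintype.card V)
    (hgood : ∀ v, k ≤ (Finset.univ.filter fun u => (a u, b u) = (a v, b v)).card)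
    (hkx : k ≤ x) (hx : x + k ≤ Fintype.card V) :
    ∃ a' : V → ℕ, (∀ v, a v ≤ a' v) ∧ (∀ v, a' v ≤ a v + 1) ∧ ∑ v, a' v = ∑ v, a v + x ∧
      ∀ v, k ≤ (Finset.univ.filter fun u => (a' u, b u) = (a' v, b v)).card := by
  obtain ⟨t, ht⟩ := exists_large_fiber a b (4 * k) n ha hb hn hcard
  obtain ⟨W, hW, hWgood⟩ := exists_refining_set (fun u => (a u, b u)) k x hgood t ht hkx hx
  refine ⟨fun v => a v + if v ∈ W then 1 else 0, fun v => Nat.le_add_right _ _, fun v => ?_, ?_,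
    fun v => (hWgood v).trans (Finset.card_le_card fun u => ?_)⟩
  · dsimp only
    split_ifs <;> omega
  · rw [Finset.sum_add_distrib, Finset.sum_ite_mem, Finset.univ_inter, Finset.sum_const, hW,
      smul_eq_mul, mul_one]
  · simp only [Finset.mem_filter, Finset.mem_univ, true_and, Prod.mk.injEq]
    rintro ⟨⟨h1, h2⟩, h3⟩
    simp only [h1, h2, h3, and_self]

/-- A digraph with sufficiently many vertices has an insertion set of fewer than
`2 * k * (maxDeg A + 2) ^ 2` arcs that makes it `k`-anonymous. -/
lemma exists_small_insertion_set (A : Finset (V × V)) (k : ℕ) (hk : 2 ≤ k)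
    (hcard : 4 * k * (maxDeg A + 2) ^ 2 ≤ Fintype.card V) :
    ∃ S : Finset (V × V), (∀ a ∈ S, a ∉ A) ∧ (∀ v, (v, v) ∉ S) ∧ kAnonymous (A ∪ S) k ∧
      S.card < 2 * k * (maxDeg A + 2) ^ 2 := by
  have hmax : ∀ v, max (inDeg A v) (outDeg A v) ≤ maxDeg A := fun v =>
    Finset.le_sup (f := fun v => max (inDeg A v) (outDeg A v)) (Finset.mem_univ v)
  set d := maxDeg A
  obtain ⟨a, b, hpa, hqb, had, hbd, hsa, hsb, hgood⟩ :=
    exists_raise_pairs_anonymous (inDeg A) (outDeg A) k d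
      (fun v => (le_max_left _ _).trans (hmax v)) (fun v => (le_max_right _ _).trans (hmax v)) hcard
  rw [sum_inDeg] at hsa
  rw [sum_outDeg] at hsb
  have hsa' : A.card ≤ ∑ v, a v := by
    rw [← sum_inDeg A]
    exact Finset.sum_le_sum fun v _ => hpa v
  have hsb' : A.card ≤ ∑ v, b v := by
    rw [← sum_outDeg A]
    exact Finset.sum_le_sum fun v _ => hqb v
  obtain ⟨T, hT⟩ : ∃ T, T + 1 = 2 * k * (d + 2) ^ 2 :=
    ⟨2 * k * (d + 2) ^ 2 - 1, Nat.sub_add_cancel (Nat.succ_le_of_lt (by positivity))⟩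
  have e1 : 2 * k * (d + 2) ^ 2 = 2 * (k * d * (d + 2)) + 4 * (k * d) + 8 * k := by ring
  have e2 : 4 * k * (d + 2) ^ 2 = 2 * (2 * k * (d + 2) ^ 2) := by ring
  have e3 : k * d * (d + 2) = k * d * d + 2 * (k * d) := by ring
  have hT3 : 3 * (d + 1) ^ 2 < T := by
    have : 2 * 2 * (d + 2) ^ 2 ≤ 2 * k * (d + 2) ^ 2 := by gcongr
    nlinarith
  obtain ⟨a', haa, haa', hsum_a, hgood_a⟩ := exists_raise_fst a b k (d + 2)
    (A.card + T - ∑ v, a v) (by omega) (fun v => by have := had v; omega)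
    (fun v => by have := hbd v; omega) hcard hgood (by omega) (by omega)
  have hswap : ∀ v, k ≤ (Finset.univ.filter fun u => (b u, a' u) = (b v, a' v)).card := fun v =>
    (hgood_a v).trans (Finset.card_le_card fun u => by
      simp only [Finset.mem_filter, Finset.mem_univ, true_and, Prod.mk.injEq]
      exact And.symm)
  obtain ⟨b', hbb, hbb', hsum_b, hgood_b⟩ := exists_raise_fst b a' k (d + 2)
    (A.card + T - ∑ v, b v) (by omega) (fun v => by have := hbd v; omega)
    (fun v => by have := had v; have := haa' v; omega) hcard hswap (by omega) (by omega)
  have hina : ∀ v, inDeg A v + (a' v - inDeg A v) = a' v := fun v =>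
    Nat.add_sub_cancel' ((hpa v).trans (haa v))
  have houtb : ∀ v, outDeg A v + (b' v - outDeg A v) = b' v := fun v =>
    Nat.add_sub_cancel' ((hqb v).trans (hbb v))
  have hF : ∑ v, (a' v - inDeg A v) = T := by
    have : ∑ v, (inDeg A v + (a' v - inDeg A v)) = ∑ v, a' v :=
      Finset.sum_congr rfl fun v _ => hina v
    rw [Finset.sum_add_distrib, sum_inDeg] at this
    omega
  have hG : ∑ v, (b' v - outDeg A v) = T := by
    have : ∑ v, (outDeg A v + (b' v - outDeg A v)) = ∑ v, b' v :=
      Finset.sum_congr rfl fun v _ => houtb v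
    rw [Finset.sum_add_distrib, sum_outDeg] at this
    omega
  obtain ⟨S, hSA, hS, hSf, hSg⟩ := exists_realization A (fun v => a' v - inDeg A v)
    (fun v => b' v - outDeg A v) (d + 1)
    (fun v => by have := hina v; have := had v; have := haa' v; omega)
    (fun v => by have := houtb v; have := hbd v; have := hbb' v; omega)
    (by rw [hF, hG]) (by rw [hF]; exact hT3)
  refine ⟨S, hSA, hS, fun v => ?_, ?_⟩
  · have hdeg : ∀ u, deg (A ∪ S) u = (a' u, b' u) := fun u => by
      rw [deg_union_of_disjoint hSA, hSf, hSg, hina, houtb]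
    simp only [hdeg]
    refine (hgood_b v).trans (Finset.card_le_card fun u => ?_)
    simp only [Finset.mem_filter, Finset.mem_univ, true_and, Prod.mk.injEq]
    exact And.symm
  · rw [← sum_inDeg S, Finset.sum_congr rfl fun v _ => hSf v, hF]
    omega

end Anonymization

lemma card_incidentVerts_le {V : Type*} [DecidableEq V] (S : Finset (V × V)) :
    (incidentVerts S).card ≤ 2 * S.card := by
  refine (Finset.card_union_le _ _).trans ?_
  rw [two_mul]
  exact add_le_add Finset.card_image_le Finset.card_image_le

/-- **Degree bound for minimum k-insertion sets touching many vertices.**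
If `S` is a minimum-size `k`-insertion set for `D` with
`|V(S)| ≥ 4k(Δ_D + 2)²`, then `Δ_{D+S} ≤ Δ_D + 2`. -/
theorem min_insertion_set_large_support {V : Type*} [Fintype V] [DecidableEq V]
    (A : Finset (V × V)) (hA : ∀ v : V, (v, v) ∉ A)
    (k : ℕ) (hk : 0 < k)
    (S : Finset (V × V))
    (hSA : ∀ a ∈ S, a ∉ A) (hSloop : ∀ v : V, (v, v) ∉ S)
    (hanon : kAnonymous (A ∪ S) k)
    (hmin : ∀ S' : Finset (V × V),
      (∀ a ∈ S', a ∉ A) → (∀ v : V, (v, v) ∉ S') → kAnonymous (A ∪ S') k →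
      S.card ≤ S'.card)
    (hbig : 4 * k * (maxDeg A + 2) ^ 2 ≤ (incidentVerts S).card) :
    maxDeg (A ∪ S) ≤ maxDeg A + 2 := by
  exfalso
  have hinc := card_incidentVerts_le S
  have hpos : 0 < k * (maxDeg A + 2) ^ 2 := by positivity
  have e : 4 * k * (maxDeg A + 2) ^ 2 = 4 * (k * (maxDeg A + 2) ^ 2) := by ring
  have e' : 2 * k * (maxDeg A + 2) ^ 2 = 2 * (k * (maxDeg A + 2) ^ 2) := by ring
  rcases Nat.lt_or_ge k 2 with hk2 | hk2
  · have := hmin ∅ (by simp) (by simp) fun v =>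
      (show k ≤ 1 by omega).trans (Finset.card_pos.2 ⟨v, by simp⟩)
    rw [Finset.card_empty] at this
    omega
  · obtain ⟨S', h1, h2, h3, h4⟩ := exists_small_insertion_set A k hk2
      (hbig.trans (Finset.card_le_univ _))
    have := hmin S' h1 h2 h3
    omega
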